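/- There exists an infinite binary sequence A with effective Hausdorff dimension dim(A) = 1/2 such that every infinite binary sequence B that is Turing-reducible to A satisfies dim(B) ≤ 1/2. -/

import Mathlib

/-- Binary strings. -/
abbrev Str := List Bool

/-- `U` is an optimal universal conditional machine: it is partial computable and,
for every partial computable `M`, programs for `M` can be translated to programs
for `U` with only a constant-length overhead. -/
def UniversalM (U : Str × Str →. Str) : Prop :=
  Partrec U ∧
    ∀ M : Str × Str →. Str, Partrec M →
      ∃ c : ℕ, ∀ x y p : Str, x ∈ M (p, y) →
        ∃ q : Str, x ∈ U (q, y) ∧ q.length ≤ p.length + c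

/-- Conditional plain Kolmogorov complexity `C(x|y)` with respect to `U`. -/
noncomputable def KC (U : Str × Str →. Str) (x y : Str) : ℕ :=
  sInf {l : ℕ | ∃ p : Str, p.length = l ∧ x ∈ U (p, y)}

/-- Unconditional plain complexity `C(x) = C(x|λ)`. -/
noncomputable def KC0 (U : Str × Str →. Str) (x : Str) : ℕ := KC U x []

/-- Complexity conditioned on (the binary representation of) a natural number. -/
noncomputable def KCn (U : Str × Str →. Str) (x : Str) (n : ℕ) : ℕ := KC U x (Nat.bits n)

/-- The length-`n` prefix of an infinite binary sequence. -/
def pre (x : ℕ → Bool) (n : ℕ) : Str := List.ofFn (fun i : Fin n => x i)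

/-- `Φ` is (the finite-use functional of) an oracle Turing machine that, with oracle
`A`, totally computes the sequence `B`: answers obtained from finite prefixes of `A`
are consistent, and every bit of `B` is obtained from some finite prefix of `A`. -/
def TuringComputes (Φ : Str → ℕ →. Bool) (A B : ℕ → Bool) : Prop :=
  (∀ (n m₁ m₂ : ℕ) (b₁ b₂ : Bool),
      b₁ ∈ Φ (pre A m₁) n → b₂ ∈ Φ (pre A m₂) n → b₁ = b₂) ∧
  (∀ n, ∃ m, B n ∈ Φ (pre A m) n)

/-- `B` is Turing-reducible to `A`. -/
def TuringLE (B A : ℕ → Bool) : Prop :=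
  ∃ Φ : Str → ℕ →. Bool, Partrec₂ Φ ∧ TuringComputes Φ A B

/-- The effective Hausdorff dimension of a sequence: `liminf C(x↾n)/n`. -/
noncomputable def dimOf (U : Str × Str →. Str) (x : ℕ → Bool) : ℝ :=
  Filter.liminf (fun n : ℕ => (KC0 U (pre x n) : ℝ) / (n : ℝ)) Filter.atTop

/-- The effective packing dimension of a sequence: `limsup C(x↾n)/n`. -/
noncomputable def DimOf (U : Str × Str →. Str) (x : ℕ → Bool) : ℝ :=
  Filter.limsup (fun n : ℕ => (KC0 U (pre x n) : ℝ) / (n : ℝ)) Filter.atTop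

/-- The weight `2^{-⌊l/2⌋}` of a string of length `l`. -/
noncomputable def wt (l : ℕ) : ℝ := (1 / 2) ^ (l / 2)

/-- The direct weight of a finite set of strings. -/
noncomputable def dw (D : Finset Str) : ℝ := ∑ d ∈ D, wt d.length

/-- The sum of the Lebesgue measures of the cylinders of a finite set of strings. -/
noncomputable def ms (D : Finset Str) : ℝ := ∑ d ∈ D, (1 / 2 : ℝ) ^ d.length

/-- Every string of `F` extends a string of `D`. -/
def Covers (D F : Finset Str) : Prop := ∀ f ∈ F, ∃ d ∈ D, d <+: f

/-- The least direct weight of a cover of `F`. -/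
noncomputable def ow (F : Finset Str) : ℝ := sInf (dw '' {D | Covers D F})

lemma wt_pos (l : ℕ) : 0 < wt l := by unfold wt; positivity

lemma wt_anti {k l : ℕ} (h : k ≤ l) : wt l ≤ wt k :=
  pow_le_pow_of_le_one (by norm_num) (by norm_num) (Nat.div_le_div_right h)

lemma half_pow_le_wt_sq (l : ℕ) : (1 / 2 : ℝ) ^ l ≤ wt l ^ 2 := by
  rw [wt, ← pow_mul]
  exact pow_le_pow_of_le_one (by norm_num) (by norm_num) (by omega)

lemma wt_sq_le (l : ℕ) : wt l ^ 2 ≤ 2 * (1 / 2 : ℝ) ^ l := by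
  have : (1 / 2 : ℝ) ^ (l / 2 * 2 + 1) ≤ (1 / 2 : ℝ) ^ l :=
    pow_le_pow_of_le_one (by norm_num) (by norm_num) (by omega)
  rw [wt, ← pow_mul]
  rw [pow_succ] at this
  linarith

lemma dw_nonneg (D : Finset Str) : 0 ≤ dw D := Finset.sum_nonneg fun _ _ => (wt_pos _).le

lemma ms_nonneg (D : Finset Str) : 0 ≤ ms D := Finset.sum_nonneg fun _ _ => by positivity

lemma dw_mono {D E : Finset Str} (h : D ⊆ E) : dw D ≤ dw E :=
  Finset.sum_le_sum_of_subset_of_nonneg h fun _ _ _ => (wt_pos _).le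

lemma dw_union_le (D E : Finset Str) : dw (D ∪ E) ≤ dw D + dw E := by
  have := Finset.sum_union_inter (s₁ := D) (s₂ := E) (f := fun d => wt d.length)
  have h := dw_nonneg (D ∩ E)
  unfold dw at *
  linarith

lemma ms_union_le (D E : Finset Str) : ms (D ∪ E) ≤ ms D + ms E := by
  have := Finset.sum_union_inter (s₁ := D) (s₂ := E) (f := fun d => (1 / 2 : ℝ) ^ d.length)
  have h := ms_nonneg (D ∩ E)
  unfold ms at *
  linarith

lemma dw_biUnion_le {ι : Type*} (s : Finset ι) (t : ι → Finset Str) :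
    dw (s.biUnion t) ≤ ∑ i ∈ s, dw (t i) := by
  classical
  induction s using Finset.induction_on with
  | empty => simp [dw]
  | insert a s ha ih =>
    rw [Finset.biUnion_insert, Finset.sum_insert ha]
    exact (dw_union_le _ _).trans (by linarith)

lemma ms_biUnion_le {ι : Type*} (s : Finset ι) (t : ι → Finset Str) :
    ms (s.biUnion t) ≤ ∑ i ∈ s, ms (t i) := by
  classical
  induction s using Finset.induction_on with
  | empty => simp [ms]
  | insert a s ha ih =>
    rw [Finset.biUnion_insert, Finset.sum_insert ha]
    exact (ms_union_le _ _).trans (by linarith)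

lemma ms_le_dw_sq (D : Finset Str) : ms D ≤ dw D ^ 2 :=
  (Finset.sum_le_sum fun d _ => half_pow_le_wt_sq d.length).trans
    (Finset.sum_sq_le_sq_sum_of_nonneg fun _ _ => (wt_pos _).le)

lemma Covers.refl (F : Finset Str) : Covers F F := fun f hf => ⟨f, hf, List.prefix_rfl⟩

lemma Covers.mono_left {D D' F : Finset Str} (h : Covers D F) (hD : D ⊆ D') : Covers D' F :=
  fun f hf => let ⟨d, hd, h⟩ := h f hf; ⟨d, hD hd, h⟩

lemma Covers.mono_right {D F F' : Finset Str} (h : Covers D F') (hF : F ⊆ F') : Covers D F :=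
  fun f hf => h f (hF hf)

lemma Covers.filter {D F : Finset Str} (h : Covers D F) {P : Str → Prop} [DecidablePred P]
    (hP : ∀ d f, d ∈ D → f ∈ F → d <+: f → P d) : Covers (D.filter P) F := by
  intro f hf
  obtain ⟨d, hd, hdf⟩ := h f hf
  exact ⟨d, Finset.mem_filter.2 ⟨hd, hP d f hd hf hdf⟩, hdf⟩

lemma ow_le {D F : Finset Str} (h : Covers D F) : ow F ≤ dw D :=
  csInf_le ⟨0, by rintro _ ⟨D, -, rfl⟩; exact dw_nonneg D⟩ ⟨D, h, rfl⟩

lemma ow_nonneg (F : Finset Str) : 0 ≤ ow F :=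
  Real.sInf_nonneg (by rintro _ ⟨D, -, rfl⟩; exact dw_nonneg D)

/-- The set of all prefixes of strings in `F`. -/
def prefixes (F : Finset Str) : Finset Str := F.biUnion fun f => f.inits.toFinset

lemma mem_prefixes {F : Finset Str} {d : Str} : d ∈ prefixes F ↔ ∃ f ∈ F, d <+: f := by
  simp [prefixes]

lemma exists_opt (F : Finset Str) : ∃ D, D ⊆ prefixes F ∧ Covers D F ∧ dw D = ow F := by
  classical
  have hne : ((prefixes F).powerset.filter fun D => Covers D F).Nonempty :=
    ⟨F, Finset.mem_filter.2 ⟨Finset.mem_powerset.2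
      fun f hf => mem_prefixes.2 ⟨f, hf, List.prefix_rfl⟩, Covers.refl F⟩⟩
  obtain ⟨D, hD, hmin⟩ := Finset.exists_min_image _ dw hne
  simp only [Finset.mem_filter, Finset.mem_powerset] at hD hmin
  refine ⟨D, hD.1, hD.2, le_antisymm (le_csInf ⟨_, D, hD.2, rfl⟩ ?_) (ow_le hD.2)⟩
  rintro _ ⟨E, hE, rfl⟩
  refine (hmin (E.filter (· ∈ prefixes F)) ⟨fun d hd => (Finset.mem_filter.1 hd).2, ?_⟩).trans
    (dw_mono (Finset.filter_subset _ _))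
  exact hE.filter fun d f _ hf hdf => mem_prefixes.2 ⟨f, hf, hdf⟩

lemma ow_le_one (F : Finset Str) : ow F ≤ 1 := by
  refine (ow_le (D := {[]}) fun f _ => ⟨[], by simp⟩).trans ?_
  simp [dw, wt]

lemma wt_le_ow {F : Finset Str} {f : Str} (hf : f ∈ F) : wt f.length ≤ ow F := by
  obtain ⟨D, -, hD, e⟩ := exists_opt F
  obtain ⟨d, hd, hdf⟩ := hD f hf
  rw [← e]
  exact (wt_anti hdf.length_le).trans
    (Finset.single_le_sum (f := fun d : Str => wt d.length) (fun _ _ => (wt_pos _).le) hd)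

/-- The elements of `F` extending `v`. -/
def above (F : Finset Str) (v : Str) : Finset Str := F.filter (v <+: ·)

lemma mem_above {F : Finset Str} {v f : Str} : f ∈ above F v ↔ f ∈ F ∧ v <+: f := by
  simp [above]

/-- If `D` covers `F`, a string without prefix in `D` is handled by the part of `D` above it. -/
lemma Covers.above {D F : Finset Str} (h : Covers D F) {v : Str} (hv : ∀ d ∈ D, ¬ d <+: v)
    (hF : ∀ f ∈ F, v <+: f) : Covers (above D v) F := by
  refine h.filter fun d f hd hf hdf => ?_
  exact (List.prefix_or_prefix_of_prefix hdf (hF f hf)).resolve_left (hv d hd)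

lemma prefix_mem_min (K : Finset Str) {v : Str} (hv : v ∈ K) :
    ∃ u ∈ K.filter (fun u => ∀ w ∈ K, w <+: u → w = u), u <+: v := by
  obtain ⟨u, hu, hmin⟩ := Finset.exists_min_image (K.filter (· <+: v)) List.length
    ⟨v, by simp [hv]⟩
  simp only [Finset.mem_filter] at hu hmin
  refine ⟨u, Finset.mem_filter.2 ⟨hu.1, fun w hw hwu => ?_⟩, hu.2⟩
  exact hwu.eq_of_length_le (hmin w ⟨hw, hwu.trans hu.2⟩)

lemma exists_cover_of_heavy (D K : Finset Str)
    (h : ∀ v ∈ K, (∃ d ∈ D, d <+: v) ∨ wt v.length ≤ 2 * dw (above D v)) :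
    ∃ D', Covers D' D ∧ Covers D' K ∧ dw D' ≤ 3 * dw D := by
  classical
  set K₂ := K.filter fun v => wt v.length ≤ 2 * dw (above D v) with hK₂
  set M := K₂.filter (fun u => ∀ w ∈ K₂, w <+: u → w = u) with hM
  refine ⟨D ∪ M, (Covers.refl D).mono_left Finset.subset_union_left, ?_, ?_⟩
  · intro v hv
    rcases h v hv with ⟨d, hd, hdv⟩ | hv'
    · exact ⟨d, Finset.mem_union_left _ hd, hdv⟩
    · obtain ⟨u, hu, huv⟩ := prefix_mem_min K₂ (Finset.mem_filter.2 ⟨hv, hv'⟩)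
      exact ⟨u, Finset.mem_union_right _ hu, huv⟩
  · have h1 : dw M ≤ ∑ v ∈ M, 2 * dw (above D v) :=
      Finset.sum_le_sum fun v hv => (Finset.mem_filter.1 (Finset.mem_filter.1 hv).1).2
    have h2 : ∑ v ∈ M, dw (above D v) ≤ dw D := by
      simp only [dw, above, Finset.sum_filter]
      rw [Finset.sum_comm]
      refine Finset.sum_le_sum fun d _ => ?_
      rw [← Finset.sum_filter, Finset.sum_const, nsmul_eq_mul]
      have : (M.filter (· <+: d)).card ≤ 1 := by
        refine Finset.card_le_one.2 fun a ha b hb => ?_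
        simp only [hM, Finset.mem_filter] at ha hb
        rcases List.prefix_or_prefix_of_prefix ha.2 hb.2 with hab | hba
        · exact hb.1.2 a ha.1.1 hab
        · exact (ha.1.2 b hb.1.1 hba).symm
      have h1 : ((M.filter (· <+: d)).card : ℝ) ≤ 1 := by exact_mod_cast this
      nlinarith [wt_pos d.length]
    rw [← Finset.mul_sum] at h1
    linarith [dw_union_le D M]

/-- If adding `F'` to `F` hardly increases the optimal weight, then the optimal cover of the union
consists of strings half filled by `F` together with a part of small weight. -/
lemma exists_light_part {F F' : Finset Str} {δ : ℝ} (h : ow (F ∪ F') < ow F + δ) :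
    ∃ D N : Finset Str, Covers D F' ∧ dw N ≤ 2 * δ ∧
      ∀ v ∈ D, v ∈ N ∨ wt v.length ≤ 2 * ow (above F v) := by
  classical
  obtain ⟨D, -, hD, e⟩ := exists_opt (F ∪ F')
  choose O _ hO hOe using exists_opt
  set N := D.filter fun v => ¬ wt v.length ≤ 2 * ow (above F v) with hN
  set H := D.filter fun v => wt v.length ≤ 2 * ow (above F v) with hH
  refine ⟨D, N, hD.mono_right Finset.subset_union_right, ?_, fun v hv => ?_⟩
  · have hc : Covers (H ∪ N.biUnion fun v => O (above F v)) F := by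
      intro f hf
      obtain ⟨d, hd, hdf⟩ := hD f (Finset.mem_union_left _ hf)
      by_cases hh : wt d.length ≤ 2 * ow (above F d)
      · exact ⟨d, Finset.mem_union_left _ (Finset.mem_filter.2 ⟨hd, hh⟩), hdf⟩
      · obtain ⟨o, ho, hof⟩ := hO (above F d) f (mem_above.2 ⟨hf, hdf⟩)
        exact ⟨o, Finset.mem_union_right _ (Finset.mem_biUnion.2
          ⟨d, Finset.mem_filter.2 ⟨hd, hh⟩, ho⟩), hof⟩
    have h1 := ow_le hc
    have h2 := dw_union_le H (N.biUnion fun v => O (above F v))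
    have h3 := dw_biUnion_le N fun v => O (above F v)
    have h4 : ∑ v ∈ N, dw (O (above F v)) ≤ ∑ v ∈ N, wt v.length / 2 := by
      refine Finset.sum_le_sum fun v hv => ?_
      rw [hOe]
      have := (Finset.mem_filter.1 hv).2
      linarith
    have h5 : ∑ v ∈ N, wt v.length / 2 = dw N / 2 := by rw [dw, Finset.sum_div]
    have h6 : dw H + dw N = dw D := Finset.sum_filter_add_sum_filter_not _ _ _
    linarith
  · by_cases hh : wt v.length ≤ 2 * ow (above F v)
    · exact Or.inr hh
    · exact Or.inl (Finset.mem_filter.2 ⟨hv, hh⟩)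

/-- The strings of length `n`. -/
def strings (n : ℕ) : Finset Str :=
  (Finset.univ : Finset (Fin n → Bool)).image List.ofFn

lemma mem_strings {n : ℕ} {s : Str} : s ∈ strings n ↔ s.length = n := by
  constructor
  · intro h
    obtain ⟨f, -, rfl⟩ := Finset.mem_image.1 h
    simp
  · rintro rfl
    exact Finset.mem_image.2 ⟨fun i => s.get i, Finset.mem_univ _, by simp⟩

lemma card_strings (n : ℕ) : (strings n).card = 2 ^ n := by
  rw [strings, Finset.card_image_of_injective _ List.ofFn_injective]
  simp

/-- The strings of length `σ.length + k` extending `σ`. -/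
def extensions (σ : Str) (k : ℕ) : Finset Str := (strings k).image (σ ++ ·)

lemma card_extensions (σ : Str) (k : ℕ) : (extensions σ k).card = 2 ^ k := by
  rw [extensions, Finset.card_image_of_injective _ (List.append_right_injective σ), card_strings]

lemma mem_extensions {σ s : Str} {k : ℕ} :
    s ∈ extensions σ k ↔ σ <+: s ∧ s.length = σ.length + k := by
  simp only [extensions, Finset.mem_image, mem_strings]
  constructor
  · rintro ⟨t, rfl, rfl⟩; simp
  · rintro ⟨⟨t, rfl⟩, h⟩; exact ⟨t, by simpa using h, rfl⟩

lemma card_extensions_above_le (σ d : Str) (k : ℕ) :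
    (((extensions σ k).filter (d <+: ·)).card : ℝ) ≤ 2 ^ (σ.length + k) * (1 / 2 : ℝ) ^ d.length := by
  rcases le_or_gt d.length (σ.length + k) with h | h
  · have hs : (extensions σ k).filter (d <+: ·) ⊆ extensions d (σ.length + k - d.length) := by
      intro s hs
      simp only [Finset.mem_filter, mem_extensions] at hs ⊢
      exact ⟨hs.2, by omega⟩
    have := Finset.card_le_card hs
    rw [card_extensions] at this
    have h2 : (2 : ℝ) ^ (σ.length + k) * (1 / 2 : ℝ) ^ d.length
        = 2 ^ (σ.length + k - d.length) := by
      obtain ⟨e, he⟩ := Nat.exists_eq_add_of_le h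
      rw [he, Nat.add_sub_cancel_left, pow_add, one_div, inv_pow]
      field_simp
    rw [h2]
    exact_mod_cast this
  · have : (extensions σ k).filter (d <+: ·) = ∅ := by
      refine Finset.filter_eq_empty_iff.2 fun s hs hd => ?_
      have := hd.length_le
      rw [(mem_extensions.1 hs).2] at this
      omega
    rw [this]
    simp

/-- `Q` is `η`-light above `σ`: every finite part of `Q` above `σ` has a cover whose weight is
at most `η` times the weight of `σ`. -/
def Light (η : ℝ) (Q : Set Str) (σ : Str) : Prop :=
  ∀ F : Finset Str, (∀ f ∈ F, f ∈ Q ∧ σ <+: f) → ow F ≤ η * wt σ.length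

/-- If `Q` has covers above `σ` of bounded weight and of measure at most `3/4` of that of `σ`,
then it is arbitrarily light above a suitable long extension of `σ`. -/
lemma exists_light_extension {Q : Set Str} {σ : Str} {Z : ℝ}
    (h : ∀ F : Finset Str, (∀ f ∈ F, f ∈ Q ∧ σ <+: f) →
      ∃ D, Covers D F ∧ dw D ≤ Z ∧ ms D ≤ 3 / 4 * (1 / 2 : ℝ) ^ σ.length)
    {η : ℝ} (hη : 0 < η) (n : ℕ) :
    ∃ σ', σ <+: σ' ∧ n ≤ σ'.length ∧ Light η Q σ' := by
  classical
  set s := σ.length with hs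
  have hlim : ∃ k, n ≤ k ∧ Z / η < 1 / 4 * 2 ^ k * wt (s + k) := by
    obtain ⟨j, hj⟩ := pow_unbounded_of_one_lt (4 * (Z / η) / (1 / 2) ^ s) (one_lt_two (α := ℝ))
    refine ⟨2 * (n + j), by omega, ?_⟩
    have h1 : (1 / 2 : ℝ) ^ s * (1 / 2) ^ (n + j) ≤ wt (s + 2 * (n + j)) := by
      rw [wt, ← pow_add]
      exact pow_le_pow_of_le_one (by norm_num) (by norm_num) (by omega)
    have h2 : (2 : ℝ) ^ j ≤ 2 ^ (n + j) := pow_le_pow_right₀ (by norm_num) (by omega)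
    rw [div_lt_iff₀ (by positivity)] at hj
    have h3 : (2 : ℝ) ^ (n + j) * (1 / 2) ^ (n + j) = 1 := by rw [← mul_pow]; norm_num
    have h4 : (2 : ℝ) ^ (2 * (n + j)) = 2 ^ (n + j) * 2 ^ (n + j) := by rw [← pow_add]; ring_nf
    have hp : (0 : ℝ) < (1 / 2) ^ s := by positivity
    calc Z / η < 1 / 4 * (2 ^ j * (1 / 2) ^ s) := by linarith
      _ ≤ 1 / 4 * (2 ^ (n + j) * (1 / 2) ^ s) := by gcongr
      _ = 1 / 4 * 2 ^ (2 * (n + j)) * ((1 / 2 : ℝ) ^ s * (1 / 2) ^ (n + j)) := by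
        rw [h4]; linear_combination -(1 / 4) * 2 ^ (n + j) * (1 / 2 : ℝ) ^ s * h3
      _ ≤ _ := by gcongr
  obtain ⟨k, hnk, hk⟩ := hlim
  by_contra! hcon
  have hbad : ∀ τ ∈ extensions σ k, ∃ F : Finset Str, (∀ f ∈ F, f ∈ Q ∧ τ <+: f) ∧
      η * wt (s + k) < ow F := by
    intro τ hτ
    rw [mem_extensions] at hτ
    have := hcon τ hτ.1 (by omega)
    simp only [Light, not_forall, not_le, exists_prop] at this
    rwa [hτ.2] at this
  choose! G hGQ hG using hbad
  obtain ⟨D, hD, hDZ, hDm⟩ := h ((extensions σ k).biUnion G) (by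
    intro f hf
    obtain ⟨τ, hτ, hf⟩ := Finset.mem_biUnion.1 hf
    exact ⟨(hGQ τ hτ f hf).1, (mem_extensions.1 hτ).1.trans (hGQ τ hτ f hf).2⟩)
  set X := extensions σ k with hX
  set P := X.filter fun τ => ∃ d ∈ D, d <+: τ with hP
  set R := X.filter fun τ => ¬ ∃ d ∈ D, d <+: τ with hR
  have hcard : (P.card : ℝ) + R.card = 2 ^ k := by
    have := Finset.card_filter_add_card_filter_not (s := X) (fun τ => ∃ d ∈ D, d <+: τ)
    rw [card_extensions] at this
    exact_mod_cast this
  have hPc : (P.card : ℝ) ≤ 3 / 4 * 2 ^ k := by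
    have h1 : P ⊆ D.biUnion fun d => X.filter (d <+: ·) := by
      intro τ hτ
      obtain ⟨h1, d, hd, hdτ⟩ := Finset.mem_filter.1 hτ
      exact Finset.mem_biUnion.2 ⟨d, hd, Finset.mem_filter.2 ⟨h1, hdτ⟩⟩
    have h2 : (P.card : ℝ) ≤ ∑ d ∈ D, ((X.filter (d <+: ·)).card : ℝ) := by
      exact_mod_cast (Finset.card_le_card h1).trans Finset.card_biUnion_le
    have h3 : ∑ d ∈ D, ((X.filter (d <+: ·)).card : ℝ) ≤ 2 ^ (s + k) * ms D := by
      rw [ms, Finset.mul_sum]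
      exact Finset.sum_le_sum fun d _ => card_extensions_above_le σ d k
    calc (P.card : ℝ) ≤ 2 ^ (s + k) * (3 / 4 * (1 / 2 : ℝ) ^ s) :=
          (h2.trans h3).trans (by gcongr)
      _ = 3 / 4 * 2 ^ k * (2 ^ s * (1 / 2 : ℝ) ^ s) := by rw [pow_add]; ring
      _ = 3 / 4 * 2 ^ k := by rw [← mul_pow]; norm_num
  have hRc : (R.card : ℝ) * (η * wt (s + k)) ≤ Z := by
    have h1 : ∀ τ ∈ R, η * wt (s + k) ≤ dw (above D τ) := by
      intro τ hτ
      obtain ⟨hτX, hno⟩ := Finset.mem_filter.1 hτ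
      push Not at hno
      refine (hG τ hτX).le.trans (ow_le (Covers.above ?_ hno fun f hf => (hGQ τ hτX f hf).2))
      exact hD.mono_right (Finset.subset_biUnion_of_mem G hτX)
    have h2 : ∑ τ ∈ R, dw (above D τ) ≤ dw D := by
      simp only [dw, above, Finset.sum_filter]
      rw [Finset.sum_comm]
      refine Finset.sum_le_sum fun d _ => ?_
      rw [← Finset.sum_filter, Finset.sum_const, nsmul_eq_mul]
      have : (R.filter (· <+: d)).card ≤ 1 := by
        refine Finset.card_le_one.2 fun a ha b hb => ?_
        simp only [hR, hX, Finset.mem_filter, mem_extensions] at ha hb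
        exact (List.prefix_of_prefix_length_le ha.2 hb.2 (by omega)).eq_of_length_le (by omega)
      have h1 : ((R.filter (· <+: d)).card : ℝ) ≤ 1 := by exact_mod_cast this
      nlinarith [wt_pos d.length]
    calc (R.card : ℝ) * (η * wt (s + k)) = ∑ τ ∈ R, η * wt (s + k) := by simp
      _ ≤ Z := (Finset.sum_le_sum h1).trans (h2.trans hDZ)
  have hw := wt_pos (s + k)
  have h1 : (R.card : ℝ) * wt (s + k) ≤ Z / η := by
    rw [le_div_iff₀ hη]; linarith
  have h2 : (1 / 4 * 2 ^ k : ℝ) * wt (s + k) ≤ R.card * wt (s + k) := by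
    gcongr; linarith
  linarith

/-- If a finite set `F` above `σ` is heavily covered by the light set `V` everywhere, and no `T τ`
noticeably increases the optimal weight of `F`, then `V` and all the `T τ` together have covers of
bounded weight and small measure above `σ`. -/
lemma exists_cover_of_saturated {V : Set Str} {σ : Str} (hV : Light (1 / 32) V σ) {h : ℕ}
    {F : Finset Str} (hF : ∀ ν ∈ F, σ <+: ν ∧ ¬ Light (1 / 2) V ν) {T : Str → Set Str}
    (hT : ∀ τ ∈ strings (2 * h), ∀ F' : Finset Str, (∀ f ∈ F', f ∈ T τ) →
      ow (F ∪ F') < ow F + (1 / 2) ^ (h + σ.length + 2))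
    (G : Finset Str) (hG : ∀ f ∈ G, (f ∈ V ∨ ∃ τ ∈ strings (2 * h), f ∈ T τ) ∧ σ <+: f) :
    ∃ D, Covers D G ∧
      dw D ≤ 10 / 32 * wt σ.length + 2 ^ (2 * h) * (2 * (1 / 2) ^ (h + σ.length + 2)) ∧
      ms D ≤ 3 / 4 * (1 / 2 : ℝ) ^ σ.length := by
  classical
  set δ : ℝ := (1 / 2) ^ (h + σ.length + 2) with hδ
  set w := wt σ.length with hw
  -- the part of `V` witnessing that it is heavy above the elements of `F`
  have h1 : ∀ ν ∈ F, ∃ K : Finset Str, (∀ f ∈ K, f ∈ V ∧ ν <+: f) ∧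
      1 / 2 * wt ν.length < ow K := by
    intro ν hν
    simpa only [Light, not_forall, not_le, exists_prop] using (hF ν hν).2
  choose! K hKV hK using h1
  obtain ⟨D₁, -, hD₁, hD₁w⟩ := exists_opt (F.biUnion K)
  have hD₁w' : dw D₁ ≤ 1 / 32 * w := by
    rw [hD₁w]
    refine hV _ fun f hf => ?_
    obtain ⟨ν, hν, hf⟩ := Finset.mem_biUnion.1 hf
    exact ⟨(hKV ν hν f hf).1, (hF ν hν).1.trans (hKV ν hν f hf).2⟩
  obtain ⟨E, -, hEF, hE⟩ := exists_cover_of_heavy D₁ F (by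
    intro ν hν
    by_contra! hcon
    have := ow_le ((hD₁.mono_right (Finset.subset_biUnion_of_mem K hν)).above hcon.1
      fun f hf => (hKV ν hν f hf).2)
    have := hK ν hν
    linarith [hcon.2])
  -- the strings half filled by `F`
  obtain ⟨H, hHE, hH, hHw⟩ := exists_cover_of_heavy E
    ((prefixes F).filter fun v => wt v.length ≤ 2 * ow (above F v)) (by
      intro v hv
      by_contra! hcon
      have := ow_le ((hEF.mono_right (Finset.filter_subset (v <+: ·) F)).above hcon.1
        fun f hf => (Finset.mem_filter.1 hf).2)
      have h2 := (Finset.mem_filter.1 hv).2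
      rw [above] at h2
      linarith [hcon.2])
  have hHhalf : ∀ v, wt v.length ≤ 2 * ow (above F v) → ∃ d ∈ H, d <+: v := by
    intro v hv
    refine hH v (Finset.mem_filter.2 ⟨?_, hv⟩)
    by_contra hno
    have hemp : above F v = ∅ := by
      refine Finset.filter_eq_empty_iff.2 fun f hf hvf => hno (mem_prefixes.2 ⟨f, hf, hvf⟩)
    have h0 : ow (above F v) ≤ 0 := by
      rw [hemp]
      exact (ow_le (D := ∅) fun f hf => by simp at hf).trans (by simp [dw])
    linarith [wt_pos v.length]
  have h2 : ∀ τ ∈ strings (2 * h), ∃ D N : Finset Str, Covers D (G.filter (· ∈ T τ)) ∧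
      dw N ≤ 2 * δ ∧ ∀ v ∈ D, v ∈ N ∨ wt v.length ≤ 2 * ow (above F v) := fun τ hτ =>
    exists_light_part (hT τ hτ _ fun f hf => (Finset.mem_filter.1 hf).2)
  choose! C N hC hNw hCN using h2
  obtain ⟨D₂, -, hD₂, hD₂w⟩ := exists_opt (G.filter (· ∈ V))
  have hD₂w' : dw D₂ ≤ 1 / 32 * w := by
    rw [hD₂w]
    refine hV _ fun f hf => ?_
    obtain ⟨hf, hfV⟩ := Finset.mem_filter.1 hf
    exact ⟨hfV, (hG f hf).2⟩
  have hB : dw (D₂ ∪ H) ≤ 10 / 32 * w := by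
    have := dw_union_le D₂ H
    linarith
  set U := (strings (2 * h)).biUnion N with hU
  refine ⟨D₂ ∪ H ∪ U, ?_, ?_, ?_⟩
  · intro f hf
    rcases (hG f hf).1 with hfV | ⟨τ, hτ, hfT⟩
    · obtain ⟨d, hd, hdf⟩ := hD₂ f (Finset.mem_filter.2 ⟨hf, hfV⟩)
      exact ⟨d, by simp [hd], hdf⟩
    · obtain ⟨d, hd, hdf⟩ := hC τ hτ f (Finset.mem_filter.2 ⟨hf, hfT⟩)
      rcases hCN τ hτ d hd with hdN | hdh
      · exact ⟨d, Finset.mem_union_right _ (Finset.mem_biUnion.2 ⟨τ, hτ, hdN⟩), hdf⟩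
      · obtain ⟨u, hu, hud⟩ := hHhalf d hdh
        exact ⟨u, by simp [hu], hud.trans hdf⟩
  · have h3 : dw U ≤ 2 ^ (2 * h) * (2 * δ) := by
      refine (dw_biUnion_le _ _).trans ((Finset.sum_le_sum hNw).trans ?_)
      simp [card_strings]
    linarith [dw_union_le (D₂ ∪ H) U]
  · have h3 : ms U ≤ 2 ^ (2 * h) * (2 * δ) ^ 2 := by
      refine (ms_biUnion_le _ _).trans ((Finset.sum_le_sum (g := fun _ => (2 * δ) ^ 2)
        fun τ hτ => ?_).trans ?_)
      · exact (ms_le_dw_sq _).trans (pow_le_pow_left₀ (dw_nonneg _) (hNw τ hτ) 2)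
      · simp [card_strings]
    have h4 : (2 : ℝ) ^ (2 * h) * (2 * δ) ^ 2 ≤ 1 / 4 * (1 / 2) ^ σ.length := by
      have e : (2 : ℝ) ^ (2 * h) * (2 * δ) ^ 2
          = (2 ^ h * (1 / 2) ^ h) ^ 2 * (1 / 4 * ((1 / 2) ^ σ.length * (1 / 2) ^ σ.length)) := by
        rw [hδ, pow_add, pow_add, pow_mul']; ring
      rw [e, ← mul_pow]
      have : ((1 : ℝ) / 2) ^ σ.length ≤ 1 := pow_le_one₀ (by norm_num) (by norm_num)
      have hp : (0 : ℝ) < (1 / 2) ^ σ.length := by positivity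
      norm_num at *
      nlinarith
    have h5 : ms (D₂ ∪ H) ≤ (10 / 32 * w) ^ 2 :=
      (ms_le_dw_sq _).trans (pow_le_pow_left₀ (dw_nonneg _) hB 2)
    have h6 := wt_sq_le σ.length
    have hp : (0 : ℝ) < (1 / 2) ^ σ.length := by positivity
    have h7 := ms_union_le (D₂ ∪ H) U
    rw [← hw] at h6
    nlinarith

lemma Light.exists_extension {V : Set Str} {ν : Str} (hV : Light (1 / 2) V ν) (n : ℕ) :
    ∃ σ', ν <+: σ' ∧ n ≤ σ'.length ∧ Light (1 / 32) V σ' := by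
  refine exists_light_extension (Z := 1 / 2 * wt ν.length) (fun F hF => ?_) (by norm_num) n
  obtain ⟨D, -, hD, hDw⟩ := exists_opt F
  have h1 : dw D ≤ 1 / 2 * wt ν.length := hDw ▸ hV F hF
  refine ⟨D, hD, h1, ?_⟩
  have h2 := (ms_le_dw_sq D).trans (pow_le_pow_left₀ (dw_nonneg _) h1 2)
  have h3 := wt_sq_le ν.length
  have hp : (0 : ℝ) < (1 / 2) ^ ν.length := by positivity
  nlinarith

lemma primrec_two_pow : Primrec fun n : ℕ => 2 ^ n := by
  refine (Primrec.nat_iterate Primrec.id (Primrec.const 1)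
    (h := fun _ m => 2 * m) (Primrec.nat_mul.comp (Primrec.const 2) Primrec.snd)).of_eq
      fun n => ?_
  induction n with
  | zero => rfl
  | succ n ih =>
    rw [id, Function.iterate_succ_apply', pow_succ']
    exact congrArg _ ih

lemma primrec_sublists {α : Type*} [Primcodable α] : Primrec (List.sublists (α := α)) := by
  have h : Primrec fun l : List α =>
      l.foldr (fun a acc => acc.flatMap fun x => [x, a :: x]) [[]] := by
    refine Primrec.list_foldr (h := fun _ (p : α × List (List α)) =>
      p.2.flatMap fun x => [x, p.1 :: x]) Primrec.id (Primrec.const [[]]) ?_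
    refine Primrec.list_flatMap (Primrec.snd.comp Primrec.snd) ?_
    exact Primrec.list_cons.comp Primrec.snd (Primrec.list_cons.comp
      (Primrec.list_cons.comp (Primrec.fst.comp (Primrec.snd.comp Primrec.fst)) Primrec.snd)
      (Primrec.const []))
  refine h.of_eq fun l => ?_
  induction l with
  | nil => rfl
  | cons a l ih => rw [List.foldr_cons, ih, List.sublists_cons]; rfl

lemma primrecRel_isPrefix : PrimrecRel fun a b : Str => a <+: b :=
  (Primrec.eq.comp Primrec.fst (Primrec.list_take.comp
    (Primrec.list_length.comp Primrec.fst) Primrec.snd)).of_eq fun _ =>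
      List.prefix_iff_eq_take.symm

/-- The list of all prefixes of the strings of `L`. -/
def prefixList (L : List Str) : List Str :=
  L.flatMap fun f => (List.range (f.length + 1)).map fun i => f.take i

lemma mem_prefixList {L : List Str} {d : Str} : d ∈ prefixList L ↔ ∃ f ∈ L, d <+: f := by
  simp only [prefixList, List.mem_flatMap, List.mem_map, List.mem_range]
  refine exists_congr fun f => and_congr_right fun _ => ⟨?_, fun h => ?_⟩
  · rintro ⟨i, -, rfl⟩
    exact List.take_prefix _ _
  · exact ⟨d.length, by have := h.length_le; omega, (List.prefix_iff_eq_take.1 h).symm⟩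

lemma primrec_prefixList : Primrec prefixList :=
  Primrec.list_flatMap Primrec.id (Primrec.list_map
    (Primrec.list_range.comp (Primrec.succ.comp (Primrec.list_length.comp Primrec.snd)))
    (Primrec.list_take.comp Primrec.snd (Primrec.snd.comp Primrec.fst)))

/-- The direct weight of a list of strings, scaled by `2 ^ n`. -/
def natDw (n : ℕ) (D : List Str) : ℕ := D.foldr (fun d acc => 2 ^ (n - d.length / 2) + acc) 0

lemma primrec_natDw : Primrec₂ natDw :=
  Primrec.list_foldr (h := fun (a : ℕ × List Str) (p : Str × ℕ) => 2 ^ (a.1 - p.1.length / 2) + p.2)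
    Primrec.snd (Primrec.const 0) (Primrec.nat_add.comp
    (primrec_two_pow.comp (Primrec.nat_sub.comp (Primrec.fst.comp Primrec.fst)
      (Primrec.nat_div.comp (Primrec.list_length.comp (Primrec.fst.comp Primrec.snd))
        (Primrec.const 2))))
    (Primrec.snd.comp Primrec.snd))

/-- The least direct weight of a cover of a list of strings, scaled by `2 ^ n`. -/
def natOw (n : ℕ) (L : List Str) : ℕ :=
  (((prefixList L).sublists.filter fun D => ∀ f ∈ L, ∃ d ∈ D, d <+: f).map (natDw n)).foldr
    min (2 ^ n)

lemma primrecRel_covers : PrimrecRel fun D L : List Str => ∀ f ∈ L, ∃ d ∈ D, d <+: f := by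
  have h : PrimrecRel fun (f : Str) (D : List Str) => ∃ d ∈ D, d <+: f :=
    (PrimrecRel.exists_mem_list primrecRel_isPrefix).comp Primrec.snd Primrec.fst
  exact (PrimrecRel.forall_mem_list h).comp Primrec.snd Primrec.fst

lemma primrec_natOw : Primrec₂ natOw := by
  refine Primrec.list_foldr (h := fun _ p => min p.1 p.2) (Primrec.list_map
    ((PrimrecRel.listFilter primrecRel_covers).comp
      (primrec_sublists.comp (primrec_prefixList.comp Primrec.snd)) Primrec.snd)
    (primrec_natDw.comp (Primrec.fst.comp Primrec.fst) Primrec.snd))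
    (primrec_two_pow.comp Primrec.fst) ?_
  exact Primrec.nat_min.comp (Primrec.fst.comp Primrec.snd) (Primrec.snd.comp Primrec.snd)

lemma natDw_eq {n : ℕ} {D : List Str} (hD : ∀ d ∈ D, d.length ≤ n) :
    (natDw n D : ℝ) = 2 ^ n * (D.map fun d => wt d.length).sum := by
  induction D with
  | nil => simp [natDw]
  | cons d D ih =>
    have h1 := ih fun x hx => hD x (List.mem_cons_of_mem _ hx)
    have h2 : d.length / 2 ≤ n := by have := hD d List.mem_cons_self; omega
    have h3 : (2 : ℝ) ^ (n - d.length / 2) = 2 ^ n * wt d.length := by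
      rw [wt, one_div, inv_pow, pow_sub₀ _ two_ne_zero h2]
    have h4 : natDw n (d :: D) = 2 ^ (n - d.length / 2) + natDw n D := rfl
    rw [h4, Nat.cast_add, h1, Nat.cast_pow, Nat.cast_ofNat, h3, List.map_cons, List.sum_cons,
      mul_add]

lemma dw_toFinset_le (D : List Str) : dw D.toFinset ≤ (D.map fun d => wt d.length).sum := by
  induction D with
  | nil => simp [dw]
  | cons d D ih =>
    rw [List.toFinset_cons, List.map_cons, List.sum_cons, Finset.insert_eq]
    refine (dw_union_le _ _).trans ?_
    rw [dw, Finset.sum_singleton]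
    linarith

lemma le_foldr_min_iff {a b : ℕ} {l : List ℕ} : a ≤ l.foldr min b ↔ a ≤ b ∧ ∀ x ∈ l, a ≤ x := by
  induction l with
  | nil => simp
  | cons c l ih => simp only [List.foldr_cons, le_min_iff, ih, List.forall_mem_cons]; tauto

lemma natOw_eq {n : ℕ} {L : List Str} (hL : ∀ f ∈ L, f.length ≤ n) :
    (natOw n L : ℝ) = 2 ^ n * ow L.toFinset := by
  have hp : ∀ D ∈ (prefixList L).sublists, ∀ d ∈ D, d.length ≤ n := fun D hD d hd => by
    obtain ⟨f, hf, hdf⟩ := mem_prefixList.1 ((List.mem_sublists.1 hD).subset hd)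
    exact hdf.length_le.trans (hL f hf)
  apply le_antisymm
  · obtain ⟨D, hD, hcov, hdw⟩ := exists_opt L.toFinset
    set S := (prefixList L).dedup.filter (· ∈ D) with hS
    have hSD : S.toFinset = D := by
      ext d
      simp only [hS, List.mem_toFinset, List.mem_filter, List.mem_dedup, decide_eq_true_eq,
        mem_prefixList]
      refine ⟨And.right, fun h => ⟨?_, h⟩⟩
      simpa using mem_prefixes.1 (hD h)
    have hnd : S.Nodup := (List.nodup_dedup _).filter _
    have hsub : S ∈ (prefixList L).sublists :=
      List.mem_sublists.2 (List.filter_sublist.trans (List.dedup_sublist _))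
    have h1 : natOw n L ≤ natDw n S := by
      refine (le_foldr_min_iff.1 (le_refl (natOw n L))).2 _ (List.mem_map_of_mem ?_)
      rw [List.mem_filter]
      refine ⟨hsub, decide_eq_true fun f hf => ?_⟩
      obtain ⟨d, hd, hdf⟩ := hcov f (List.mem_toFinset.2 hf)
      rw [← hSD, List.mem_toFinset] at hd
      exact ⟨d, hd, hdf⟩
    rw [← hdw, ← hSD, dw, List.sum_toFinset _ hnd, ← natDw_eq (hp S hsub)]
    exact_mod_cast h1
  · have key : ⌈(2 : ℝ) ^ n * ow L.toFinset⌉₊ ≤ natOw n L := by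
      refine le_foldr_min_iff.2 ⟨Nat.ceil_le.2 ?_, fun x hx => ?_⟩
      · rw [Nat.cast_pow, Nat.cast_ofNat]
        exact mul_le_of_le_one_right (by positivity) (ow_le_one _)
      · obtain ⟨D, hD, rfl⟩ := List.mem_map.1 hx
        obtain ⟨hD1, hD2⟩ := List.mem_filter.1 hD
        rw [Nat.ceil_le, natDw_eq (hp D hD1)]
        refine mul_le_mul_of_nonneg_left (le_trans (ow_le ?_) (dw_toFinset_le D)) (by positivity)
        intro f hf
        obtain ⟨d, hd, hdf⟩ := of_decide_eq_true hD2 f (List.mem_toFinset.1 hf)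
        exact ⟨d, List.mem_toFinset.2 hd, hdf⟩
    exact (Nat.le_ceil _).trans (by exact_mod_cast key)

/-- Within `n` steps, and using only prefixes of `f` (which must extend `σ`) as oracle, the code
`c` outputs every bit of `τ`. -/
def OutputsIn (c : Nat.Partrec.Code) (σ : Str) (n : ℕ) (τ f : Str) : Prop :=
  σ <+: f ∧ ∀ i ∈ List.range τ.length, ∃ j ∈ List.range (f.length + 1),
    Nat.Partrec.Code.evaln n c (Encodable.encode (f.take j, i)) =
      (τ[i]?).map Encodable.encode

instance (c : Nat.Partrec.Code) (σ : Str) (n : ℕ) (τ f : Str) :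
    Decidable (OutputsIn c σ n τ f) := inferInstanceAs (Decidable (_ ∧ _))

lemma primrecRel_outputsIn (c : Nat.Partrec.Code) (σ : Str) :
    PrimrecRel fun (f : Str) (a : ℕ × Str) => OutputsIn c σ a.1 a.2 f := by
  have h1 : PrimrecRel fun (j : ℕ) (a : ℕ × Str × ℕ × Str) =>
      Nat.Partrec.Code.evaln a.2.2.1 c (Encodable.encode (a.2.1.take j, a.1)) =
        (a.2.2.2[a.1]?).map Encodable.encode := by
    refine Primrec.eq.comp (Nat.Partrec.Code.primrec_evaln.comp (Primrec.pair (Primrec.pair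
      (Primrec.fst.comp (Primrec.snd.comp (Primrec.snd.comp Primrec.snd))) (Primrec.const c))
      (Primrec.encode.comp (Primrec.pair (Primrec.list_take.comp Primrec.fst
        (Primrec.fst.comp (Primrec.snd.comp Primrec.snd))) (Primrec.fst.comp Primrec.snd))))) ?_
    exact Primrec.option_map (Primrec.list_getElem?.comp
      (Primrec.snd.comp (Primrec.snd.comp (Primrec.snd.comp Primrec.snd)))
      (Primrec.fst.comp Primrec.snd)) (Primrec.encode.comp Primrec.snd)
  have h2 : PrimrecRel fun (i : ℕ) (a : Str × ℕ × Str) => ∃ j ∈ List.range (a.1.length + 1),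
      Nat.Partrec.Code.evaln a.2.1 c (Encodable.encode (a.1.take j, i)) =
        (a.2.2[i]?).map Encodable.encode :=
    (PrimrecRel.exists_mem_list h1).comp (Primrec.list_range.comp (Primrec.succ.comp
      (Primrec.list_length.comp (Primrec.fst.comp Primrec.snd)))) Primrec.id
  exact (primrecRel_isPrefix.comp (Primrec.const σ) Primrec.fst).and
    ((PrimrecRel.forall_mem_list h2).comp
    (Primrec.list_range.comp (Primrec.list_length.comp (Primrec.snd.comp Primrec.snd)))
    Primrec.id)

lemma OutputsIn.mono {c : Nat.Partrec.Code} {σ τ f : Str} {m n : ℕ} (h : OutputsIn c σ m τ f)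
    (hmn : m ≤ n) : OutputsIn c σ n τ f := by
  refine ⟨h.1, fun i hi => ?_⟩
  obtain ⟨j, hj, he⟩ := h.2 i hi
  refine ⟨j, hj, ?_⟩
  have hi' : i < τ.length := List.mem_range.1 hi
  rw [List.getElem?_eq_getElem hi', Option.map_some] at he ⊢
  exact Nat.Partrec.Code.evaln_mono hmn he

/-- Using only prefixes of `f` (which must extend `σ`) as oracle, the code `c` outputs every bit
of `τ`. -/
def Outputs (c : Nat.Partrec.Code) (σ τ f : Str) : Prop := ∃ n, OutputsIn c σ n τ f

lemma outputs_iff {c : Nat.Partrec.Code} {σ τ f : Str} : Outputs c σ τ f ↔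
    σ <+: f ∧ ∀ i (hi : i < τ.length), ∃ j ≤ f.length,
      Encodable.encode τ[i] ∈ c.eval (Encodable.encode (f.take j, i)) := by
  constructor
  · rintro ⟨n, h1, h2⟩
    refine ⟨h1, fun i hi => ?_⟩
    obtain ⟨j, hj, he⟩ := h2 i (List.mem_range.2 hi)
    rw [List.getElem?_eq_getElem hi, Option.map_some] at he
    exact ⟨j, Nat.lt_succ_iff.1 (List.mem_range.1 hj),
      Nat.Partrec.Code.evaln_complete.2 ⟨n, he⟩⟩
  · rintro ⟨h1, h2⟩
    have h3 : ∀ i : Fin τ.length, ∃ n, ∃ j ≤ f.length, Encodable.encode τ[i] ∈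
        Nat.Partrec.Code.evaln n c (Encodable.encode (f.take j, (i : ℕ))) := fun i => by
      obtain ⟨j, hj, he⟩ := h2 i i.2
      obtain ⟨n, hn⟩ := Nat.Partrec.Code.evaln_complete.1 he
      exact ⟨n, j, hj, hn⟩
    choose n hn using h3
    refine ⟨Finset.univ.sup n, h1, fun i hi => ?_⟩
    have hi' := List.mem_range.1 hi
    obtain ⟨j, hj, he⟩ := hn ⟨i, hi'⟩
    refine ⟨j, List.mem_range.2 (Nat.lt_succ_iff.2 hj), ?_⟩
    rw [List.getElem?_eq_getElem hi', Option.map_some]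
    exact Nat.Partrec.Code.evaln_mono (Finset.le_sup (Finset.mem_univ _)) he

lemma Outputs.mono {c : Nat.Partrec.Code} {σ τ f g : Str} (h : Outputs c σ τ f) (hfg : f <+: g) :
    Outputs c σ τ g := by
  rw [outputs_iff] at h ⊢
  refine ⟨h.1.trans hfg, fun i hi => ?_⟩
  obtain ⟨j, hj, he⟩ := h.2 i hi
  refine ⟨j, hj.trans hfg.length_le, ?_⟩
  have : f.take j = g.take j := by
    obtain ⟨t, rfl⟩ := hfg
    rw [List.take_append_of_le_length hj]
  rwa [← this]

/-- `t = (τ, L', n)` witnesses that adding strings computing `τ`, of length `2 h`, to `L` raises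
the weight by `2 ^ (-(h + k))`. -/
def Enlarges (c : Nat.Partrec.Code) (σ : Str) (k : ℕ) (a : ℕ × List Str)
    (t : Str × List Str × ℕ) : Prop :=
  t.1.length = 2 * a.1 ∧ (∀ f ∈ t.2.1, OutputsIn c σ t.2.2 t.1 f) ∧
    (∀ f ∈ t.2.1 ++ a.2, f.length ≤ t.2.2) ∧ a.1 + k ≤ t.2.2 ∧
    natOw t.2.2 a.2 + 2 ^ (t.2.2 - (a.1 + k)) ≤ natOw t.2.2 (t.2.1 ++ a.2)

instance (c : Nat.Partrec.Code) (σ : Str) (k : ℕ) (a : ℕ × List Str) (t : Str × List Str × ℕ) :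
    Decidable (Enlarges c σ k a t) := inferInstanceAs (Decidable (_ ∧ _))

lemma primrecRel_enlarges (c : Nat.Partrec.Code) (σ : Str) (k : ℕ) :
    PrimrecRel (Enlarges c σ k) := by
  have hn : Primrec fun x : (ℕ × List Str) × (Str × List Str × ℕ) => x.2.2.2 :=
    Primrec.snd.comp (Primrec.snd.comp Primrec.snd)
  have hL' : Primrec fun x : (ℕ × List Str) × (Str × List Str × ℕ) => x.2.2.1 :=
    Primrec.fst.comp (Primrec.snd.comp Primrec.snd)
  have hL : Primrec fun x : (ℕ × List Str) × (Str × List Str × ℕ) => x.1.2 :=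
    Primrec.snd.comp Primrec.fst
  have hh : Primrec fun x : (ℕ × List Str) × (Str × List Str × ℕ) => x.1.1 :=
    Primrec.fst.comp Primrec.fst
  have ht : Primrec fun x : (ℕ × List Str) × (Str × List Str × ℕ) => x.2.1 :=
    Primrec.fst.comp Primrec.snd
  have hk := Primrec.nat_add.comp hh (Primrec.const k)
  have hA := Primrec.list_append.comp hL' hL
  have hlen : PrimrecRel fun (f : Str) (n : ℕ) => f.length ≤ n :=
    Primrec.nat_le.comp (Primrec.list_length.comp Primrec.fst) Primrec.snd
  refine PrimrecPred.and (Primrec.eq.comp (Primrec.list_length.comp ht)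
    (Primrec.nat_mul.comp (Primrec.const 2) hh)) (PrimrecPred.and
    ((PrimrecRel.forall_mem_list (primrecRel_outputsIn c σ)).comp hL' (hn.pair ht))
    (PrimrecPred.and ((PrimrecRel.forall_mem_list hlen).comp hA hn)
    (PrimrecPred.and (Primrec.nat_le.comp hk hn) (Primrec.nat_le.comp
    (Primrec.nat_add.comp (primrec_natOw.comp hn hL)
      (primrec_two_pow.comp (Primrec.nat_sub.comp hn hk)))
    (primrec_natOw.comp hn hA)))))

/-- Search for an enlargement of `L`, where `a = (h, L)`. -/
def enlarge (c : Nat.Partrec.Code) (σ : Str) (k : ℕ) (a : ℕ × List Str) : Part (Str × List Str) :=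
  Nat.rfindOpt fun w => (Encodable.decode w : Option (Str × List Str × ℕ)).bind fun t =>
    if Enlarges c σ k a t then some (t.1, t.2.1 ++ a.2) else none

lemma partrec_enlarge (c : Nat.Partrec.Code) (σ : Str) (k : ℕ) : Partrec (enlarge c σ k) := by
  refine Partrec.rfindOpt (Primrec.to_comp (Primrec.option_bind
    (Primrec.decode.comp Primrec.snd) (Primrec.ite ((primrecRel_enlarges c σ k).comp
      (Primrec.fst.comp Primrec.fst) Primrec.snd) ?_ (Primrec.const none))))
  exact Primrec.option_some.comp (Primrec.pair (Primrec.fst.comp Primrec.snd)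
    (Primrec.list_append.comp (Primrec.fst.comp (Primrec.snd.comp Primrec.snd))
      (Primrec.snd.comp (Primrec.fst.comp Primrec.fst))))

lemma enlarges_iff {c : Nat.Partrec.Code} {σ : Str} {k h n : ℕ} {L L' : List Str} {τ : Str}
    (hL : ∀ f ∈ L' ++ L, f.length ≤ n) (hn : h + k ≤ n) :
    Enlarges c σ k (h, L) (τ, L', n) ↔ τ.length = 2 * h ∧ (∀ f ∈ L', OutputsIn c σ n τ f) ∧
      ow L.toFinset + (1 / 2) ^ (h + k) ≤ ow (L' ++ L).toFinset := by
  have h1 : natOw n L + 2 ^ (n - (h + k)) ≤ natOw n (L' ++ L) ↔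
      ow L.toFinset + (1 / 2) ^ (h + k) ≤ ow (L' ++ L).toFinset := by
    rw [← Nat.cast_le (α := ℝ), Nat.cast_add, natOw_eq hL,
      natOw_eq fun f hf => hL f (List.mem_append_right _ hf), Nat.cast_pow, Nat.cast_ofNat,
      pow_sub₀ _ two_ne_zero hn, ← inv_pow, ← one_div, ← mul_add]
    exact mul_le_mul_iff_right₀ (by positivity)
  simp only [Enlarges, h1]
  tauto

lemma of_mem_enlarge {c : Nat.Partrec.Code} {σ : Str} {k h : ℕ} {L L₁ : List Str} {τ : Str}
    (hx : (τ, L₁) ∈ enlarge c σ k (h, L)) : τ.length = 2 * h ∧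
      (∀ f ∈ L₁, f ∈ L ∨ Outputs c σ τ f) ∧
      ow L.toFinset + (1 / 2) ^ (h + k) ≤ ow L₁.toFinset := by
  obtain ⟨w, hw⟩ := Nat.rfindOpt_spec hx
  obtain ⟨⟨τ', L', n⟩, -, ht⟩ := Option.mem_bind_iff.1 hw
  split_ifs at ht with hE
  · simp only [Option.mem_def, Option.some.injEq, Prod.mk.injEq] at ht
    obtain ⟨rfl, rfl⟩ := ht
    obtain ⟨h1, h2, h3⟩ := (enlarges_iff hE.2.2.1 hE.2.2.2.1).1 hE
    refine ⟨h1, fun f hf => ?_, h3⟩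
    rcases List.mem_append.1 hf with hf | hf
    exacts [Or.inr ⟨n, h2 f hf⟩, Or.inl hf]
  · simp at ht

lemma enlarge_dom {c : Nat.Partrec.Code} {σ : Str} {k h : ℕ} {L : List Str} {τ : Str}
    (hτ : τ.length = 2 * h) {F : Finset Str} (hF : ∀ f ∈ F, Outputs c σ τ f)
    (hw : ow L.toFinset + (1 / 2) ^ (h + k) ≤ ow (L.toFinset ∪ F)) :
    (enlarge c σ k (h, L)).Dom := by
  choose! m hm using hF
  set n := max (h + k) (max (F.sup m) ((F.toList ++ L).toFinset.sup List.length)) with hn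
  have hE : Enlarges c σ k (h, L) (τ, F.toList, n) := by
    refine (enlarges_iff (fun f hf => ?_) (le_max_left _ _)).2 ⟨hτ, fun f hf => ?_, ?_⟩
    · exact (Finset.le_sup (f := List.length) (List.mem_toFinset.2 hf)).trans
        ((le_max_right _ _).trans (le_max_right _ _))
    · have hf' := Finset.mem_toList.1 hf
      exact (hm f hf').mono ((Finset.le_sup (f := m) hf').trans
        ((le_max_left _ _).trans (le_max_right _ _)))
    · rwa [List.toFinset_append, Finset.toList_toFinset, Finset.union_comm]
  refine Nat.rfindOpt_dom.2 ⟨Encodable.encode (τ, F.toList, n), (τ, F.toList ++ L), ?_⟩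
  rw [Encodable.encodek, Option.bind_some, if_pos hE]
  rfl

/-- The result of `n` successive enlargements, starting from the empty list. -/
def chain (c : Nat.Partrec.Code) (σ : Str) (k h n : ℕ) : Part (List Str) :=
  Nat.rec (Part.some []) (fun _ IH => IH.bind fun L => (enlarge c σ k (h, L)).map Prod.snd) n

lemma mem_chain_succ {c : Nat.Partrec.Code} {σ : Str} {k h n : ℕ} {L₁ : List Str} :
    L₁ ∈ chain c σ k h (n + 1) ↔
      ∃ L ∈ chain c σ k h n, ∃ τ, (τ, L₁) ∈ enlarge c σ k (h, L) := by
  change L₁ ∈ (chain c σ k h n).bind _ ↔ _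
  simp

/-- The number with binary digits `p`. -/
def val (p : Str) : ℕ := p.foldr (fun b acc => 2 * acc + b.toNat) 0

lemma primrec_val : Primrec val :=
  Primrec.list_foldr (h := fun _ (q : Bool × ℕ) => 2 * q.2 + q.1.toNat) Primrec.id
    (Primrec.const 0) (Primrec.nat_add.comp (Primrec.nat_mul.comp (Primrec.const 2)
      (Primrec.snd.comp Primrec.snd))
    ((Primrec.dom_bool Bool.toNat).comp (Primrec.fst.comp Primrec.snd)))

lemma exists_val_eq (l : ℕ) : ∀ n < 2 ^ l, ∃ p : Str, p.length = l ∧ val p = n := by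
  induction l with
  | zero => exact fun n hn => ⟨[], rfl, by simp at hn; simp [val, hn]⟩
  | succ l ih =>
    intro n hn
    obtain ⟨p, hp, hv⟩ := ih (n / 2) (by rw [pow_succ] at hn; omega)
    refine ⟨decide (n % 2 = 1) :: p, by simp [hp], ?_⟩
    change 2 * val p + _ = n
    rw [hv]
    rcases Nat.mod_two_eq_zero_or_one n with h | h <;> simp [h] <;> omega

lemma partrec_chainOutput (c : Nat.Partrec.Code) (σ : Str) (k : ℕ) :
    Partrec fun x : Str × Str => (chain c σ k (x.1.length - k) (val x.1)).bind fun L =>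
      (enlarge c σ k (x.1.length - k, L)).map Prod.fst := by
  have hh : Computable fun x : Str × Str => x.1.length - k :=
    (Primrec.nat_sub.comp (Primrec.list_length.comp Primrec.fst) (Primrec.const k)).to_comp
  have hstep : Partrec₂ fun (x : Str × Str) (q : ℕ × List Str) =>
      (enlarge c σ k (x.1.length - k, q.2)).map Prod.snd :=
    Partrec.map ((partrec_enlarge c σ k).comp ((hh.comp Computable.fst).pair
      (Computable.snd.comp Computable.snd))) (Computable.snd.comp Computable.snd).to₂
  have hlast : Partrec₂ fun (x : Str × Str) (L : List Str) =>
      (enlarge c σ k (x.1.length - k, L)).map Prod.fst :=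
    Partrec.map ((partrec_enlarge c σ k).comp ((hh.comp Computable.fst).pair
      Computable.snd)) (Computable.fst.comp Computable.snd).to₂
  have hchain : Partrec fun x : Str × Str => chain c σ k (x.1.length - k) (val x.1) :=
    Partrec.nat_rec (primrec_val.comp Primrec.fst).to_comp
      (Computable.const ([] : List Str)).partrec hstep
  exact hchain.bind hlast

lemma KC0_le_of_mem {U : Str × Str →. Str} {x q : Str} (h : x ∈ U (q, [])) :
    KC0 U x ≤ q.length :=
  Nat.sInf_le ⟨q, rfl, h⟩

/-- A computable set of strings that is saturated with respect to the outputs of `c`, all of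
whose elements compute a string of small complexity. -/
lemma exists_saturated {U : Str × Str →. Str} (hU : UniversalM U) (c : Nat.Partrec.Code)
    (σ : Str) (k : ℕ) : ∃ c₀ : ℕ, ∀ h, ∃ F : Finset Str,
      (∀ ν ∈ F, ∃ τ : Str, τ.length = 2 * h ∧ Outputs c σ τ ν ∧ KC0 U τ ≤ h + k + c₀) ∧
      ∀ τ ∈ strings (2 * h), ∀ F' : Finset Str, (∀ f ∈ F', Outputs c σ τ f) →
        ow (F ∪ F') < ow F + (1 / 2) ^ (h + k) := by
  obtain ⟨c₀, hc₀⟩ := hU.2 _ (partrec_chainOutput c σ k)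
  refine ⟨c₀, fun h => ?_⟩
  have hw : ∀ n, ∀ L ∈ chain c σ k h n, n * (1 / 2 : ℝ) ^ (h + k) ≤ ow L.toFinset := by
    intro n
    induction n with
    | zero => exact fun L _ => by rw [Nat.cast_zero, zero_mul]; exact ow_nonneg _
    | succ n ih =>
      intro L₁ hL₁
      obtain ⟨L, hL, τ, hτ⟩ := mem_chain_succ.1 hL₁
      have h1 := (of_mem_enlarge hτ).2.2
      have h2 := ih L hL
      push_cast
      linarith
  have hb : ∀ n, (chain c σ k h n).Dom → n ≤ 2 ^ (h + k) := by
    intro n hn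
    have h1 := (hw n _ (Part.get_mem hn)).trans (ow_le_one _)
    rw [one_div, inv_pow, ← div_eq_mul_inv, div_le_one (by positivity)] at h1
    exact_mod_cast h1
  have hK : ∀ n, ∀ L ∈ chain c σ k h n, ∀ ν ∈ L,
      ∃ τ : Str, τ.length = 2 * h ∧ Outputs c σ τ ν ∧ KC0 U τ ≤ h + k + c₀ := by
    intro n
    induction n with
    | zero =>
      intro L hL ν hν
      have : L = [] := Part.mem_some_iff.1 hL
      simp [this] at hν
    | succ n ih =>
      intro L₁ hL₁ ν hν
      obtain ⟨L, hL, τ, hτ⟩ := mem_chain_succ.1 hL₁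
      obtain ⟨h1, h2, -⟩ := of_mem_enlarge hτ
      rcases h2 ν hν with hν | hν
      · exact ih L hL ν hν
      refine ⟨τ, h1, hν, ?_⟩
      obtain ⟨p, hp, hv⟩ := exists_val_eq (h + k) n (hb _ (Part.dom_iff_mem.2 ⟨_, hL₁⟩))
      have hM : τ ∈ (chain c σ k (p.length - k) (val p)).bind fun L =>
          (enlarge c σ k (p.length - k, L)).map Prod.fst := by
        rw [hp, hv, Nat.add_sub_cancel]
        exact Part.mem_bind hL (Part.mem_map Prod.fst hτ)
      obtain ⟨q, hq, hql⟩ := hc₀ τ [] p hM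
      exact (KC0_le_of_mem hq).trans (hp ▸ hql)
  have hex : ∃ n, (chain c σ k h n).Dom ∧ ¬(chain c σ k h (n + 1)).Dom := by
    by_contra! hcon
    have : ∀ n, (chain c σ k h n).Dom := fun n => by
      induction n with
      | zero => trivial
      | succ n ih => exact hcon n ih
    have := hb _ (this (2 ^ (h + k) + 1))
    omega
  obtain ⟨n, hn, hn'⟩ := hex
  obtain ⟨L, hL⟩ := Part.dom_iff_mem.1 hn
  refine ⟨L.toFinset, fun ν hν => hK n L hL ν (List.mem_toFinset.1 hν), fun τ hτ F' hF' => ?_⟩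
  by_contra! hcon
  obtain ⟨⟨τ', L₁⟩, hx⟩ := Part.dom_iff_mem.1 (enlarge_dom (mem_strings.1 hτ) hF' hcon)
  exact hn' (Part.dom_iff_mem.2 ⟨L₁, mem_chain_succ.2 ⟨L, hL, τ', hx⟩⟩)

lemma length_pre (A : ℕ → Bool) (n : ℕ) : (pre A n).length = n := List.length_ofFn

lemma getElem_pre (A : ℕ → Bool) {n i : ℕ} (hi : i < (pre A n).length) : (pre A n)[i] = A i := by
  simp [pre]

lemma take_pre (A : ℕ → Bool) {m n : ℕ} (h : m ≤ n) : (pre A n).take m = pre A m := by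
  refine List.ext_getElem (by simp [length_pre, h]) fun i h1 h2 => ?_
  rw [List.getElem_take, getElem_pre, getElem_pre]

lemma pre_isPrefix (A : ℕ → Bool) {m n : ℕ} (h : m ≤ n) : pre A m <+: pre A n := by
  rw [← take_pre A h]
  exact List.take_prefix _ _

/-- The code `c` computes the functional `Φ`. -/
def CodeFor (c : Nat.Partrec.Code) (Φ : Str → ℕ →. Bool) : Prop :=
  ∀ s n, c.eval (Encodable.encode (s, n)) = (Φ s n).map Encodable.encode

lemma exists_codeFor {Φ : Str → ℕ →. Bool} (h : Partrec₂ Φ) : ∃ c, CodeFor c Φ := by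
  obtain ⟨c, hc⟩ := Nat.Partrec.Code.exists_code.1 h
  refine ⟨c, fun s n => ?_⟩
  rw [hc]
  simp

lemma CodeFor.encode_mem {c : Nat.Partrec.Code} {Φ : Str → ℕ →. Bool} (h : CodeFor c Φ) {s : Str}
    {n : ℕ} {b : Bool} :
    Encodable.encode b ∈ c.eval (Encodable.encode (s, n)) ↔ b ∈ Φ s n := by
  rw [h, Part.mem_map_iff]
  exact ⟨fun ⟨b', hb, he⟩ => Encodable.encode_injective he ▸ hb, fun hb => ⟨b, hb, rfl⟩⟩

lemma TuringComputes.eq_pre {c : Nat.Partrec.Code} {Φ : Str → ℕ →. Bool} {A B : ℕ → Bool}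
    (h : TuringComputes Φ A B) (hc : CodeFor c Φ) {σ τ : Str} {l : ℕ}
    (hτ : Outputs c σ τ (pre A l)) : pre B τ.length = τ := by
  refine List.ext_getElem (length_pre _ _) fun i h1 h2 => ?_
  obtain ⟨j, hj, he⟩ := (outputs_iff.1 hτ).2 i h2
  rw [length_pre] at hj
  rw [take_pre A hj, hc.encode_mem] at he
  obtain ⟨m, hm⟩ := h.2 i
  rw [getElem_pre]
  exact h.1 _ _ _ _ _ hm he

lemma TuringComputes.exists_outputs {c : Nat.Partrec.Code} {Φ : Str → ℕ →. Bool}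
    {A B : ℕ → Bool} (h : TuringComputes Φ A B) (hc : CodeFor c Φ) (l m : ℕ) :
    ∃ l', Outputs c (pre A l) (pre B m) (pre A l') := by
  choose u hu using h.2
  refine ⟨max l ((Finset.range m).sup u), outputs_iff.2
    ⟨pre_isPrefix A (le_max_left _ _), fun i hi => ⟨u i, ?_, ?_⟩⟩⟩
  all_goals
    have hu' : u i ≤ max l ((Finset.range m).sup u) :=
      (Finset.le_sup (Finset.mem_range.2 (length_pre B m ▸ hi))).trans (le_max_right _ _)
  · rwa [length_pre]
  · rw [take_pre A hu', hc.encode_mem, getElem_pre]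
    exact hu i

/-- `V` is closed under extension of strings. -/
def ExtClosed (V : Set Str) : Prop := ∀ f ∈ V, ∀ g, f <+: g → g ∈ V

lemma exists_step {U : Str × Str →. Str} (hU : UniversalM U) {V : Set Str} {σ : Str}
    (hV : Light (1 / 32) V σ) (hVc : ExtClosed V) (c : Nat.Partrec.Code) (n : ℕ) :
    ∃ (σ' : Str) (V' : Set Str), σ <+: σ' ∧ n ≤ σ'.length ∧ V ⊆ V' ∧ Light (1 / 32) V' σ' ∧
      ExtClosed V' ∧ ∀ A B : ℕ → Bool, pre A σ'.length = σ' → (∀ l, pre A l ∉ V') →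
        ∀ Φ, CodeFor c Φ → TuringComputes Φ A B →
          ∃ m ≥ n, 0 < m ∧ (KC0 U (pre B m) : ℝ) ≤ (1 / 2 + 1 / (n + 1)) * m := by
  obtain ⟨c₀, hc₀⟩ := exists_saturated hU c σ (σ.length + 2)
  set h := (n + 1) * (σ.length + 2 + c₀) with hh
  obtain ⟨F, hF, hT⟩ := hc₀ h
  by_cases hcase : ∃ ν ∈ F, Light (1 / 2) V ν
  · obtain ⟨ν, hν, hl⟩ := hcase
    obtain ⟨σ', h1, h2, h3⟩ := hl.exists_extension n
    obtain ⟨τ, hτ, hout, hK⟩ := hF ν hν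
    refine ⟨σ', V, hout.choose_spec.1.trans h1, h2, subset_rfl, h3, hVc, ?_⟩
    intro A B hA _ Φ hΦ hAB
    have hpre := hAB.eq_pre hΦ (hA.symm ▸ hout.mono h1 : Outputs c σ τ (pre A σ'.length))
    have hnh : n + 1 ≤ h := Nat.le_mul_of_pos_right _ (by omega)
    refine ⟨2 * h, by omega, by omega, ?_⟩
    rw [← hτ, hpre, hτ]
    have h4 : (KC0 U τ : ℝ) ≤ h + (σ.length + 2 + c₀ : ℕ) := by
      exact_mod_cast hK.trans (by omega)
    refine h4.trans (le_of_sub_nonneg ?_)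
    have h5 : (h : ℝ) = (n + 1) * (σ.length + 2 + c₀ : ℕ) := by rw [hh]; push_cast; ring
    have h6 : (1 / 2 + 1 / ((n : ℝ) + 1)) * (2 * h : ℕ) - (h + (σ.length + 2 + c₀ : ℕ)) =
        (σ.length + 2 + c₀ : ℕ) := by
      rw [Nat.cast_mul, h5]
      field_simp
      push_cast
      ring
    rw [h6]
    positivity
  · push Not at hcase
    set Q : Set Str := V ∪ {f | ∃ τ ∈ strings (2 * h), Outputs c σ τ f} with hQ
    obtain ⟨σ', h1, h2, h3⟩ := exists_light_extension (Q := Q) (σ := σ)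
      (exists_cover_of_saturated hV (T := fun τ => {f | Outputs c σ τ f})
        (fun ν hν => ⟨(hF ν hν).choose_spec.2.1.choose_spec.1, hcase ν hν⟩) hT)
      (η := 1 / 32) (by norm_num) n
    refine ⟨σ', Q, h1, h2, Set.subset_union_left, h3, ?_, ?_⟩
    · rintro f (hf | ⟨τ, hτ, hf⟩) g hfg
      · exact Or.inl (hVc f hf g hfg)
      · exact Or.inr ⟨τ, hτ, hf.mono hfg⟩
    · intro A B hA hAQ Φ hΦ hAB
      have hσ : pre A σ.length = σ := by
        rw [← take_pre A h1.length_le, hA]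
        exact (List.prefix_iff_eq_take.1 h1).symm
      obtain ⟨l, hl⟩ := hAB.exists_outputs hΦ σ.length (2 * h)
      rw [hσ] at hl
      exact absurd (Or.inr ⟨_, mem_strings.2 (length_pre _ _), hl⟩) (hAQ l)

lemma exists_program {U : Str × Str →. Str} (hU : UniversalM U) (x : Str) :
    ∃ q : Str, q.length = KC0 U x ∧ x ∈ U (q, []) := by
  obtain ⟨c, hc⟩ := hU.2 (fun a => Part.some a.1) Computable.fst.partrec
  obtain ⟨q, hq, -⟩ := hc x [] x (Part.mem_some x)
  exact Nat.sInf_mem (s := {l | ∃ p : Str, p.length = l ∧ x ∈ U (p, [])}) ⟨_, q, rfl, hq⟩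

lemma card_le_of_KC0_le {U : Str × Str →. Str} (hU : UniversalM U) {S : Finset Str} {K : ℕ}
    (hS : ∀ x ∈ S, KC0 U x ≤ K) : S.card ≤ 2 ^ (K + 1) := by
  choose q hq hqU using exists_program hU
  have h1 : S.card ≤ ((Finset.range (K + 1)).biUnion strings).card := by
    refine Finset.card_le_card_of_injOn q (fun x hx => ?_) fun x _ y _ hxy => ?_
    · refine Finset.mem_coe.2 (Finset.mem_biUnion.2
        ⟨KC0 U x, Finset.mem_range.2 (Nat.lt_succ_iff.2 (hS x hx)), mem_strings.2 (hq x)⟩)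
    · have := hqU x
      rw [hxy] at this
      exact Part.mem_unique this (hqU y)
  refine h1.trans (Finset.card_biUnion_le.trans ?_)
  simp_rw [card_strings]
  exact (Nat.geomSum_lt le_rfl fun i hi => Finset.mem_range.1 hi).le

/-- A logarithmic slack term, large enough for `2 ^ (-slack l)` to be summable. -/
def slack (l : ℕ) : ℕ := 8 + 2 * Nat.log 2 (l + 1)

/-- The strings having a prefix of complexity below half of its length minus the slack. -/
def simple (U : Str × Str →. Str) : Set Str :=
  {x | ∃ y, y <+: x ∧ KC0 U y + slack y.length ≤ y.length / 2}

lemma extClosed_simple (U : Str × Str →. Str) : ExtClosed (simple U) :=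
  fun _ ⟨y, hy, h⟩ _ hg => ⟨y, hy.trans hg, h⟩

lemma two_mul_half_pow_slack_le (l : ℕ) :
    2 * (1 / 2 : ℝ) ^ slack l ≤ 1 / 32 * (1 / (l + 1) - 1 / (l + 2)) := by
  have h1 : l + 2 ≤ 2 ^ (Nat.log 2 (l + 1) + 1) := Nat.lt_pow_succ_log_self one_lt_two _
  have h2 : ((l : ℝ) + 2) ≤ 2 ^ (Nat.log 2 (l + 1) + 1) := by exact_mod_cast h1
  have h3 : (64 : ℝ) * ((l + 1) * (l + 2)) ≤ 2 ^ slack l := by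
    have h4 : (2 : ℝ) ^ slack l = 64 * (2 ^ (Nat.log 2 (l + 1) + 1)) ^ 2 := by
      rw [slack, pow_add, pow_mul']; ring
    rw [h4]
    have : (0 : ℝ) ≤ l := Nat.cast_nonneg l
    nlinarith
  have h5 : (1 : ℝ) / 32 * (1 / (l + 1) - 1 / (l + 2)) = 2 / (64 * ((l + 1) * (l + 2))) := by
    field_simp
    ring
  rw [h5, one_div, inv_pow, ← div_eq_mul_inv]
  exact div_le_div_of_nonneg_left zero_le_two (by positivity) h3

lemma light_simple {U : Str × Str →. Str} (hU : UniversalM U) : Light (1 / 32) (simple U) [] := by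
  classical
  intro F hF
  set P : ℕ → Finset Str := fun l => (strings l).filter fun y => KC0 U y + slack l ≤ l / 2 with hP
  have hPw : ∀ l, dw (P l) ≤ 1 / 32 * (1 / (l + 1) - 1 / (l + 2)) := by
    intro l
    refine le_trans ?_ (two_mul_half_pow_slack_le l)
    have h1 : dw (P l) = (P l).card * wt l := by
      rw [dw, Finset.sum_congr rfl fun d hd => by
        rw [mem_strings.1 (Finset.mem_filter.1 hd).1], Finset.sum_const, nsmul_eq_mul]
    rcases lt_or_ge (l / 2) (slack l) with hl | hl
    · have : P l = ∅ := Finset.filter_eq_empty_iff.2 fun y _ hy => by omega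
      rw [h1, this]
      simp
    · have h2 : (P l).card ≤ 2 ^ (l / 2 - slack l + 1) := card_le_of_KC0_le hU fun x hx => by
        have := (Finset.mem_filter.1 hx).2
        omega
      have h3 : ((P l).card : ℝ) ≤ 2 ^ (l / 2 - slack l + 1) := by exact_mod_cast h2
      rw [h1]
      refine (mul_le_mul_of_nonneg_right h3 (wt_pos l).le).trans_eq ?_
      rw [pow_succ, pow_sub₀ _ two_ne_zero hl, wt, one_div, inv_pow, inv_pow]
      field_simp
  have hcov : Covers ((Finset.range (F.sup List.length + 1)).biUnion P) F := by
    intro f hf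
    obtain ⟨y, hy, hK⟩ := (hF f hf).1
    refine ⟨y, Finset.mem_biUnion.2 ⟨y.length, Finset.mem_range.2 (Nat.lt_succ_iff.2
      (hy.length_le.trans (Finset.le_sup (f := List.length) hf))), ?_⟩, hy⟩
    exact Finset.mem_filter.2 ⟨mem_strings.2 rfl, hK⟩
  refine (ow_le hcov).trans ((dw_biUnion_le _ _).trans
    ((Finset.sum_le_sum fun l _ => hPw l).trans ?_))
  have htel : ∀ N : ℕ, ∑ l ∈ Finset.range N, (1 / 32 : ℝ) * (1 / (l + 1) - 1 / (l + 2)) =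
      1 / 32 * (1 - 1 / (N + 1)) := by
    intro N
    induction N with
    | zero => simp
    | succ N ih =>
      rw [Finset.sum_range_succ, ih]
      push_cast
      ring
  rw [htel, List.length_nil]
  have : (0 : ℝ) ≤ 1 / (((F.sup List.length + 1 : ℕ) : ℝ) + 1) := by positivity
  simp only [wt, Nat.zero_div, pow_zero]
  linarith

/-- A string together with an upward closed set to be avoided by its extensions. -/
abbrev Condition := {x : Str × Set Str // Light (1 / 32) x.2 x.1 ∧ ExtClosed x.2}

lemma exists_limit (s : ℕ → Condition) (h1 : ∀ e, (s e).1.1 <+: (s (e + 1)).1.1)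
    (h2 : ∀ e, (s e).1.2 ⊆ (s (e + 1)).1.2) (h3 : ∀ e, e ≤ (s (e + 1)).1.1.length) :
    ∃ A : ℕ → Bool, (∀ e, pre A (s e).1.1.length = (s e).1.1) ∧ ∀ e l, pre A l ∉ (s e).1.2 := by
  have hpre : ∀ {d e}, d ≤ e → (s d).1.1 <+: (s e).1.1 := fun {d e} hde => by
    induction hde with
    | refl => exact List.prefix_rfl
    | step _ ih => exact ih.trans (h1 _)
  have hA : ∀ e, pre (fun i => ((s (i + 2)).1.1[i]?).getD false) (s e).1.1.length =
      (s e).1.1 := by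
    intro e
    refine List.ext_getElem (length_pre _ _) fun i hi hi' => ?_
    have hi2 : i < (s (i + 2)).1.1.length := h3 (i + 1)
    rw [getElem_pre, List.getElem?_eq_getElem hi2, Option.getD_some]
    rcases le_total (i + 2) e with h | h
    · exact (hpre h).getElem hi2
    · exact ((hpre h).getElem hi').symm
  refine ⟨_, hA, fun e l hl => ?_⟩
  set d := max e l + 1 with hd
  have hVd : (s e).1.2 ⊆ (s d).1.2 :=
    monotone_nat_of_le_succ (f := fun e => (s e).1.2) h2 (by omega)
  have hmem : (s d).1.1 ∈ (s d).1.2 := by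
    refine (s d).2.2 _ (hVd hl) _ ?_
    conv_rhs => rw [← hA d]
    exact pre_isPrefix _ ((le_max_right e l).trans (h3 _))
  have hlight := (s d).2.1 {(s d).1.1} fun f hf => by
    rw [Finset.mem_singleton.1 hf]
    exact ⟨hmem, List.prefix_rfl⟩
  have hw := wt_le_ow (Finset.mem_singleton_self (s d).1.1)
  have := wt_pos (s d).1.1.length
  linarith

lemma isLittleO_slack : (fun l => (slack l : ℝ)) =o[Filter.atTop] fun l : ℕ => (l : ℝ) := by
  have h0 : (fun l : ℕ => Real.log (l + 1)) =o[Filter.atTop] fun l : ℕ => ((l : ℝ) + 1) :=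
    Real.isLittleO_log_id_atTop.comp_tendsto
      (Filter.tendsto_atTop_add_const_right _ 1 tendsto_natCast_atTop_atTop)
  have h1 : (fun l : ℕ => ((l : ℝ) + 1)) =O[Filter.atTop] fun l : ℕ => (l : ℝ) := by
    refine Asymptotics.IsBigO.of_bound 2 (Filter.eventually_atTop.2 ⟨1, fun l hl => ?_⟩)
    have : (1 : ℝ) ≤ l := by exact_mod_cast hl
    rw [Real.norm_of_nonneg (by positivity), Real.norm_of_nonneg (by positivity)]
    linarith
  have h2 : (fun _ : ℕ => (8 : ℝ)) =o[Filter.atTop] fun l : ℕ => (l : ℝ) :=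
    Asymptotics.isLittleO_const_left.2 (Or.inr
      (tendsto_norm_atTop_atTop.comp tendsto_natCast_atTop_atTop))
  refine Asymptotics.IsBigO.trans_isLittleO (Asymptotics.IsBigO.of_bound 1 (.of_forall fun l => ?_))
    (h2.add ((h0.trans_isBigO h1).const_mul_left (2 / Real.log 2)))
  have h3 : (Nat.log 2 (l + 1) : ℝ) ≤ Real.log (l + 1) / Real.log 2 := by
    have := Real.natLog_le_logb (l + 1) 2
    rw [Real.logb] at this
    exact_mod_cast this
  have h4 : 0 ≤ Real.log (l + 1) := Real.log_nonneg (by linarith [Nat.cast_nonneg (α := ℝ) l])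
  have h5 : 0 < Real.log 2 := Real.log_pos one_lt_two
  rw [one_mul, Real.norm_of_nonneg (by positivity), Real.norm_of_nonneg (by positivity), slack]
  push_cast
  have : 2 / Real.log 2 * Real.log (l + 1) = 2 * (Real.log (l + 1) / Real.log 2) := by ring
  rw [this]
  linarith

lemma dimOf_le_half {U : Str × Str →. Str} {B : ℕ → Bool}
    (h : ∀ N : ℕ, ∃ n ≥ N, ∃ m ≥ n, 0 < m ∧
      (KC0 U (pre B m) : ℝ) ≤ (1 / 2 + 1 / (n + 1)) * m) : dimOf U B ≤ 1 / 2 := by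
  refine le_of_forall_pos_le_add fun ε hε => Filter.liminf_le_of_frequently_le ?_
    (Filter.isBoundedUnder_of ⟨0, fun n => by positivity⟩)
  refine Filter.frequently_atTop.2 fun N => ?_
  obtain ⟨K, hK⟩ := exists_nat_one_div_lt hε
  obtain ⟨n, hn, m, hm, hm0, hle⟩ := h (max N K)
  refine ⟨m, (le_max_left _ _).trans (hn.trans hm), ?_⟩
  rw [div_le_iff₀ (by exact_mod_cast hm0)]
  have hKn : (K : ℝ) ≤ n := by exact_mod_cast (le_max_right _ _).trans hn
  have h1 : (1 : ℝ) / (n + 1) ≤ 1 / (K + 1) :=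
    one_div_le_one_div_of_le (by positivity) (by linarith)
  exact hle.trans (mul_le_mul_of_nonneg_right (by linarith) (Nat.cast_nonneg m))

lemma half_le_dimOf {U : Str × Str →. Str} {A : ℕ → Bool} (h : ∀ l, pre A l ∉ simple U)
    (hb : Filter.IsCoboundedUnder (· ≥ ·) Filter.atTop
      fun n : ℕ => (KC0 U (pre A n) : ℝ) / n) : 1 / 2 ≤ dimOf U A := by
  refine le_of_forall_pos_sub_le fun ε hε => Filter.le_liminf_of_le hb ?_
  have h1 : ∀ᶠ n : ℕ in Filter.atTop, (1 : ℝ) ≤ ε * n :=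
    (Filter.Tendsto.const_mul_atTop hε tendsto_natCast_atTop_atTop).eventually_ge_atTop 1
  filter_upwards [isLittleO_slack.bound (half_pos hε), h1, Filter.eventually_gt_atTop 0]
    with n hn hn1 hn0
  have hn0' : (0 : ℝ) < n := by exact_mod_cast hn0
  rw [le_div_iff₀ hn0']
  rw [Real.norm_of_nonneg (by positivity), Real.norm_of_nonneg (by positivity)] at hn
  have h2 : n / 2 < KC0 U (pre A n) + slack n := by
    by_contra! hcon
    exact h n ⟨pre A n, List.prefix_rfl, by rwa [length_pre]⟩
  have h3 : n + 1 ≤ 2 * (KC0 U (pre A n) + slack n) := by omega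
  have h4 : ((n : ℝ) + 1) ≤ 2 * (KC0 U (pre A n) + slack n) := by exact_mod_cast h3
  nlinarith

lemma TuringLE.refl (A : ℕ → Bool) : TuringLE A A := by
  refine ⟨fun s n => (s[n]? : Part Bool), Computable.ofOption Primrec.list_getElem?.to_comp, ?_, ?_⟩
  · have h : ∀ n m b, b ∈ ((pre A m)[n]? : Part Bool) → b = A n := fun n m b hb => by
      obtain ⟨h1, h2⟩ := List.getElem?_eq_some_iff.1 (Part.mem_coe.1 hb)
      rw [← h2, getElem_pre]
    exact fun n m₁ m₂ b₁ b₂ h1 h2 => (h _ _ _ h1).trans (h _ _ _ h2).symm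
  · refine fun n => ⟨n + 1, Part.mem_coe.2 (List.getElem?_eq_some_iff.2 ⟨?_, getElem_pre _ _⟩)⟩
    rw [length_pre]
    exact n.lt_succ_self

/-- Miller: there is a sequence `A` of effective Hausdorff dimension
`1/2` such that every sequence Turing-reducible to `A` has dimension at most `1/2`. -/
theorem stmt14 (U : Str × Str →. Str) (hU : UniversalM U) :
    ∃ A : ℕ → Bool, dimOf U A = 1 / 2 ∧
      ∀ B : ℕ → Bool, TuringLE B A → dimOf U B ≤ 1 / 2 := by
  choose σ' V' h1 h2 h3 h4 h5 h6 using fun (x : Condition) (e : ℕ) =>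
    exists_step hU x.2.1 x.2.2 (Denumerable.ofNat Nat.Partrec.Code e.unpair.1) e
  set s : ℕ → Condition := fun e => Nat.rec ⟨([], simple U), light_simple hU, extClosed_simple U⟩
    (fun e x => ⟨(σ' x e, V' x e), h4 x e, h5 x e⟩) e with hs
  obtain ⟨A, hA, hAV⟩ := exists_limit s (fun e => h1 (s e) e) (fun e => h3 (s e) e)
    fun e => h2 (s e) e
  have hB : ∀ B, TuringLE B A → ∀ N : ℕ, ∃ n ≥ N, ∃ m ≥ n, 0 < m ∧
      (KC0 U (pre B m) : ℝ) ≤ (1 / 2 + 1 / (n + 1)) * m := by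
    rintro B ⟨Φ, hΦ, hAB⟩ N
    obtain ⟨c, hc⟩ := exists_codeFor hΦ
    set e := Nat.pair (Encodable.encode c) N with he
    refine ⟨e, Nat.right_le_pair _ _, h6 (s e) e A B (hA (e + 1)) (hAV (e + 1)) Φ ?_ hAB⟩
    rwa [he, Nat.unpair_pair, Denumerable.ofNat_encode]
  refine ⟨A, le_antisymm (dimOf_le_half (hB A (.refl A))) (half_le_dimOf (hAV 0) ?_),
    fun B h => dimOf_le_half (hB B h)⟩
  refine Filter.IsCoboundedUnder.of_frequently_le (a := 3 / 2)
    (Filter.frequently_atTop.2 fun N => ?_)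
  obtain ⟨n, hn, m, hm, hm0, hle⟩ := hB A (.refl A) N
  refine ⟨m, hn.trans hm, ?_⟩
  rw [div_le_iff₀ (by exact_mod_cast hm0)]
  refine hle.trans (mul_le_mul_of_nonneg_right ?_ (Nat.cast_nonneg m))
  have : (1 : ℝ) / (n + 1) ≤ 1 := by
    rw [div_le_one (by positivity)]
    linarith [Nat.cast_nonneg (α := ℝ) n]
  linarith
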